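/- For every integer N ≥ 0, the finite sum D_N(q) := ∑_{j=0}^{⌊N/2⌋} (−1)^j q^{j(3j+1−2N)/2} [N−j choose j]_q satisfies: D_N(q) = (−1)^s q^{−s(3s−1)/2} if N = 3s; D_N(q) = (−1)^s q^{−s(3s+1)/2} if N = 3s+1; and D_N(q) = 0 if N = 3s+2. (Here q is an indeterminate or any nonzero complex number not a root of unity of relevant order; the identity holds as an identity of Laurent polynomials in q.) -/

import Mathlib

/-- Finite q-Pochhammer symbol `(z;q)_n`. -/
noncomputable def qp (z q : ℂ) (n : ℕ) : ℂ := ∏ r ∈ Finset.range n, (1 - z * q ^ r)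

/-- Gaussian (q-binomial) coefficient `[M choose K]_q`. -/
noncomputable def qbinom (q : ℂ) (M K : ℕ) : ℂ :=
  if K ≤ M then qp q q M / (qp q q K * qp q q (M - K)) else 0

/-- `D_N(q) = ∑_{j=0}^{⌊N/2⌋} (-1)^j q^{j(3j+1-2N)/2} [N-j choose j]_q`
(note `j(3j+1-2N)/2 = j(3j+1)/2 - jN`, where `j(3j+1)` is always even). -/
noncomputable def DD (q : ℂ) (N : ℕ) : ℂ :=
  ∑ j ∈ Finset.range (N / 2 + 1),
    (-1 : ℂ) ^ j * q ^ (((j * (3 * j + 1) / 2 : ℕ) : ℤ) - (j : ℤ) * (N : ℤ)) *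
      qbinom q (N - j) j

lemma qp_self_succ (q : ℂ) (n : ℕ) : qp q q (n + 1) = qp q q n * (1 - q ^ (n + 1)) := by
  simp only [qp, Finset.prod_range_succ, pow_succ']

lemma one_sub_pow_succ_ne_zero {q : ℂ} (hq' : ∀ n : ℕ, 0 < n → q ^ n ≠ 1) (n : ℕ) :
    1 - q ^ (n + 1) ≠ 0 :=
  sub_ne_zero.2 (hq' _ n.succ_pos).symm

lemma qp_self_ne_zero {q : ℂ} (hq' : ∀ n : ℕ, 0 < n → q ^ n ≠ 1) (n : ℕ) : qp q q n ≠ 0 := by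
  induction n with
  | zero => simp [qp]
  | succ n ih =>
    rw [qp_self_succ]
    exact mul_ne_zero ih (one_sub_pow_succ_ne_zero hq' n)

lemma qbinom_of_lt (q : ℂ) {M K : ℕ} (h : M < K) : qbinom q M K = 0 :=
  if_neg h.not_ge

lemma qbinom_zero_right {q : ℂ} (hq' : ∀ n : ℕ, 0 < n → q ^ n ≠ 1) (M : ℕ) :
    qbinom q M 0 = 1 := by
  have h := qp_self_ne_zero hq' M
  have h0 : qp q q 0 = 1 := by simp [qp]
  simp [qbinom, h0, h]

lemma qbinom_self {q : ℂ} (hq' : ∀ n : ℕ, 0 < n → q ^ n ≠ 1) (M : ℕ) : qbinom q M M = 1 := by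
  have h := qp_self_ne_zero hq' M
  have h0 : qp q q 0 = 1 := by simp [qp]
  simp [qbinom, h0, h]

lemma qbinom_add (q : ℂ) (K d : ℕ) :
    qbinom q (K + d) K = qp q q (K + d) / (qp q q K * qp q q d) := by
  simp [qbinom]

/-- The `q`-Pascal rule with the power of `q` on the coefficient of the same lower index. -/
lemma qbinom_succ_succ {q : ℂ} (hq' : ∀ n : ℕ, 0 < n → q ^ n ≠ 1) (M K : ℕ) :
    qbinom q (M + 1) (K + 1) = q ^ (K + 1) * qbinom q M (K + 1) + qbinom q M K := by
  rcases lt_trichotomy M K with h | rfl | h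
  · simp [qbinom_of_lt q h, qbinom_of_lt q (Nat.succ_lt_succ h),
      qbinom_of_lt q (h.trans K.lt_succ_self)]
  · simp [qbinom_self hq', qbinom_of_lt q M.lt_succ_self]
  · obtain ⟨d, rfl⟩ := Nat.exists_eq_add_of_lt h
    have h₁ := qbinom_add q (K + 1) (d + 1)
    have h₂ := qbinom_add q (K + 1) d
    have h₃ := qbinom_add q K (d + 1)
    rw [show K + 1 + (d + 1) = K + d + 1 + 1 by ring] at h₁
    rw [show K + 1 + d = K + d + 1 by ring] at h₂
    rw [← add_assoc] at h₃
    have hK := qp_self_ne_zero hq' K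
    have hd := qp_self_ne_zero hq' d
    have hK' := one_sub_pow_succ_ne_zero hq' K
    have hd' := one_sub_pow_succ_ne_zero hq' d
    rw [h₁, h₂, h₃, qp_self_succ q (K + d + 1), qp_self_succ q K, qp_self_succ q d]
    field_simp
    ring

/-- The `q`-Pascal rule with the power of `q` on the coefficient of the smaller lower index. -/
lemma qbinom_succ_succ' {q : ℂ} (hq' : ∀ n : ℕ, 0 < n → q ^ n ≠ 1) (M K : ℕ) :
    qbinom q (M + 1) (K + 1) =
      qbinom q M (K + 1) + q ^ ((M : ℤ) - K) * qbinom q M K := by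
  rcases lt_trichotomy M K with h | rfl | h
  · simp [qbinom_of_lt q h, qbinom_of_lt q (Nat.succ_lt_succ h),
      qbinom_of_lt q (h.trans K.lt_succ_self)]
  · simp [qbinom_self hq', qbinom_of_lt q M.lt_succ_self]
  · obtain ⟨d, rfl⟩ := Nat.exists_eq_add_of_lt h
    have h₁ := qbinom_add q (K + 1) (d + 1)
    have h₂ := qbinom_add q (K + 1) d
    have h₃ := qbinom_add q K (d + 1)
    rw [show K + 1 + (d + 1) = K + d + 1 + 1 by ring] at h₁
    rw [show K + 1 + d = K + d + 1 by ring] at h₂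
    rw [← add_assoc] at h₃
    have hK := qp_self_ne_zero hq' K
    have hd := qp_self_ne_zero hq' d
    have hK' := one_sub_pow_succ_ne_zero hq' K
    have hd' := one_sub_pow_succ_ne_zero hq' d
    have he : ((K + d + 1 : ℕ) : ℤ) - K = ((d + 1 : ℕ) : ℤ) := by push_cast; ring
    rw [h₁, h₂, h₃, he, zpow_natCast, qp_self_succ q (K + d + 1), qp_self_succ q K,
      qp_self_succ q d]
    field_simp
    ring

/-- The exponent of `q` in the `j`-th term of `DD q N`. -/
def pentExp (N j : ℕ) : ℤ := ((j * (3 * j + 1) / 2 : ℕ) : ℤ) - (j : ℤ) * (N : ℤ)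

lemma pentExp_zero (N : ℕ) : pentExp N 0 = 0 := by simp [pentExp]

lemma pentExp_succ_left (N j : ℕ) : pentExp (N + 1) j = pentExp N j - j := by
  simp only [pentExp]
  push_cast
  ring

lemma pentExp_succ_right (N j : ℕ) : pentExp N (j + 1) = pentExp N j + 3 * j + 2 - N := by
  have h : (j + 1) * (3 * (j + 1) + 1) / 2 = j * (3 * j + 1) / 2 + (3 * j + 2) := by
    rw [← Nat.add_mul_div_right _ _ two_pos]
    ring_nf
  simp only [pentExp, h]
  push_cast
  ring

/-- The variant of `DD q N` whose `j`-th term carries an additional factor `q ^ j`. -/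
noncomputable def twistedDD (q : ℂ) (N : ℕ) : ℂ :=
  ∑ j ∈ Finset.range (N + 1), (-1 : ℂ) ^ j * q ^ (pentExp N j + j) * qbinom q (N - j) j

lemma DD_eq_sum_range_succ (q : ℂ) (N : ℕ) :
    DD q N = ∑ j ∈ Finset.range (N + 1), (-1 : ℂ) ^ j * q ^ pentExp N j * qbinom q (N - j) j := by
  refine Finset.sum_subset (Finset.range_subset_range.2 (by omega)) fun j _ hj => ?_
  rw [Finset.mem_range] at hj
  rw [qbinom_of_lt q (by omega), mul_zero]

lemma DD_succ {q : ℂ} (hq' : ∀ n : ℕ, 0 < n → q ^ n ≠ 1) (N : ℕ) :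
    DD q (N + 1) = ∑ j ∈ Finset.range (N + 1),
      (-1 : ℂ) ^ (j + 1) * q ^ pentExp (N + 1) (j + 1) * qbinom q (N - j) (j + 1) + 1 := by
  rw [DD_eq_sum_range_succ, Finset.sum_range_succ']
  simp [pentExp_zero, qbinom_zero_right hq']

lemma DD_add_two {q : ℂ} (hq : q ≠ 0) (hq' : ∀ n : ℕ, 0 < n → q ^ n ≠ 1) (N : ℕ) :
    DD q (N + 2) = DD q (N + 1) - q ^ (-(N : ℤ)) * twistedDD q N := by
  rw [DD_succ hq' (N + 1), DD_succ hq' N, twistedDD, Finset.sum_range_succ,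
    qbinom_of_lt q (by omega), mul_zero, add_zero, Finset.mul_sum, add_sub_right_comm,
    ← Finset.sum_sub_distrib]
  refine congrArg (· + 1) (Finset.sum_congr rfl fun j hj => ?_)
  rw [Finset.mem_range] at hj
  have h₁ : pentExp (N + 1) (j + 1) = pentExp (N + 1 + 1) (j + 1) + (j + 1 : ℕ) := by
    rw [pentExp_succ_left (N + 1)]; ring
  have h₂ : pentExp (N + 1 + 1) (j + 1) = -(N : ℤ) + (pentExp N j + j) := by
    rw [pentExp_succ_right, pentExp_succ_left, pentExp_succ_left]; push_cast; ring
  rw [show N + 1 - j = N - j + 1 by omega, qbinom_succ_succ hq', h₁, zpow_add₀ hq, zpow_natCast,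
    h₂, zpow_add₀ hq (-(N : ℤ))]
  ring

lemma twistedDD_add_two {q : ℂ} (hq : q ≠ 0) (hq' : ∀ n : ℕ, 0 < n → q ^ n ≠ 1) (N : ℕ) :
    twistedDD q (N + 2) = DD q (N + 1) - q * DD q N := by
  rw [twistedDD, Finset.sum_range_succ', Finset.sum_range_succ,
    qbinom_of_lt q (show N + 2 - (N + 1 + 1) < N + 1 + 1 by omega), DD_succ hq' N,
    DD_eq_sum_range_succ, Finset.mul_sum, add_sub_right_comm, ← Finset.sum_sub_distrib, mul_zero,
    add_zero]
  refine congrArg₂ (· + ·) (Finset.sum_congr rfl fun j hj => ?_)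
    (by simp [pentExp_zero, qbinom_zero_right hq'])
  rw [Finset.mem_range] at hj
  have h₁ : pentExp (N + 2) (j + 1) + (j + 1 : ℕ) = pentExp (N + 1) (j + 1) := by
    rw [pentExp_succ_left (N + 1)]; ring
  have h₂ : q ^ pentExp (N + 1) (j + 1) * q ^ (((N - j : ℕ) : ℤ) - j) = q * q ^ pentExp N j := by
    rw [← zpow_add₀ hq, ← zpow_one_add₀ hq, pentExp_succ_right, pentExp_succ_left,
      Nat.cast_sub (by omega)]
    congr 1
    push_cast
    ring
  rw [show N + 2 - (j + 1) = N - j + 1 by omega, qbinom_succ_succ' hq', h₁]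
  linear_combination (-1 : ℂ) ^ (j + 1) * qbinom q (N - j) j * h₂

lemma DD_zero {q : ℂ} (hq' : ∀ n : ℕ, 0 < n → q ^ n ≠ 1) : DD q 0 = 1 := by
  simp [DD, qbinom_zero_right hq']

lemma DD_one {q : ℂ} (hq' : ∀ n : ℕ, 0 < n → q ^ n ≠ 1) : DD q 1 = 1 := by
  simp [DD, qbinom_zero_right hq']

lemma DD_two {q : ℂ} (hq : q ≠ 0) (hq' : ∀ n : ℕ, 0 < n → q ^ n ≠ 1) : DD q 2 = 0 := by
  simp [DD_add_two hq hq' 0, DD_one hq', twistedDD, pentExp_zero, qbinom_zero_right hq']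

lemma DD_add_three {q : ℂ} (hq : q ≠ 0) (hq' : ∀ n : ℕ, 0 < n → q ^ n ≠ 1) (N : ℕ) :
    DD q (N + 3) = -q ^ (-(N : ℤ) - 1) * DD q N := by
  induction N with
  | zero =>
    simp [DD_add_two hq hq' 1, DD_two hq hq', DD_zero hq', twistedDD, pentExp_zero,
      qbinom_zero_right hq', Finset.sum_range_succ, qbinom_of_lt q zero_lt_one]
  | succ N ih =>
    have h : q ^ (-(N : ℤ) - 1) = q ^ (-((N + 2 : ℕ) : ℤ)) * q := by
      rw [← zpow_add_one₀ hq]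
      congr 1
      push_cast
      ring
    rw [show N + 1 + 3 = N + 2 + 2 by ring, DD_add_two hq hq', twistedDD_add_two hq hq',
      show N + 2 + 1 = N + 3 by ring, ih, h,
      show -((N + 1 : ℕ) : ℤ) - 1 = -((N + 2 : ℕ) : ℤ) by push_cast; ring]
    ring

/-- Finite form of Euler's pentagonal number theorem. -/
theorem stmt_12 (q : ℂ) (hq : q ≠ 0) (hq' : ∀ n : ℕ, 0 < n → q ^ n ≠ 1) (s : ℕ) :
    DD q (3 * s) = (-1 : ℂ) ^ s * q ^ (-((s * (3 * s - 1) / 2 : ℕ) : ℤ)) ∧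
    DD q (3 * s + 1) = (-1 : ℂ) ^ s * q ^ (-((s * (3 * s + 1) / 2 : ℕ) : ℤ)) ∧
    DD q (3 * s + 2) = 0 := by
  induction s with
  | zero => simp [DD_zero hq', DD_one hq', DD_two hq hq']
  | succ s ih =>
    obtain ⟨h₀, h₁, h₂⟩ := ih
    have e₀ : (s + 1) * (3 * (s + 1) - 1) / 2 = s * (3 * s - 1) / 2 + (3 * s + 1) := by
      rw [← Nat.add_mul_div_right _ _ two_pos]
      congr 1
      cases s with
      | zero => rfl
      | succ s =>
        rw [show 3 * (s + 1 + 1) - 1 = 3 * s + 5 by omega,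
          show 3 * (s + 1) - 1 = 3 * s + 2 by omega]
        ring
    have e₁ : (s + 1) * (3 * (s + 1) + 1) / 2 = s * (3 * s + 1) / 2 + (3 * s + 2) := by
      rw [← Nat.add_mul_div_right _ _ two_pos]
      ring_nf
    refine ⟨?_, ?_, ?_⟩
    · rw [show 3 * (s + 1) = 3 * s + 3 by ring, DD_add_three hq hq', h₀,
        show 3 * s + 3 = 3 * (s + 1) by ring, e₀,
        show -((s * (3 * s - 1) / 2 + (3 * s + 1) : ℕ) : ℤ) =
          -((3 * s : ℕ) : ℤ) - 1 + -((s * (3 * s - 1) / 2 : ℕ) : ℤ) by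
            rw [Nat.cast_add]; push_cast; ring, zpow_add₀ hq]
      ring
    · rw [show 3 * (s + 1) + 1 = 3 * s + 1 + 3 by ring, DD_add_three hq hq', h₁,
        show 3 * s + 1 + 3 = 3 * (s + 1) + 1 by ring, e₁,
        show -((s * (3 * s + 1) / 2 + (3 * s + 2) : ℕ) : ℤ) =
          -((3 * s + 1 : ℕ) : ℤ) - 1 + -((s * (3 * s + 1) / 2 : ℕ) : ℤ) by
            rw [Nat.cast_add]; push_cast; ring, zpow_add₀ hq]
      ring
    · rw [show 3 * (s + 1) + 2 = 3 * s + 2 + 3 by ring, DD_add_three hq hq', h₂, mul_zero]
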